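/- Fix a prior P(S,Y) and ε>0. For any ε-IP Blackwell optimal information structure P̂(S,Y,T̂), there exist a finite set 𝒯 with |𝒯| ≤ 3|𝒮|+1, an ε-IP Blackwell optimal information structure P(S,Y,T) with the same marginal on (S,Y), and a map φ:𝒯̂→𝒯 with P(S=s,Y=y,T=t) = Σ_{t̂:φ(t̂)=t} P̂(S=s,Y=y,T̂=t̂) for all s,y,t, such that for every convex function u:[0,1]→ℝ, Σ_{t:P(T=t)>0} P(T=t)·u(P(Y=1|T=t)) = Σ_{t̂:P̂(T̂=t̂)>0} P̂(T̂=t̂)·u(P̂(Y=1|T̂=t̂)). -/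

import Mathlib

open Real
open scoped Classical

noncomputable section

namespace IPPaper

variable {S T : Type} [Fintype S] [Fintype T]

/-- Marginal probability of the secret `S`. -/
def pS (P : S → Bool → T → ℝ) (s : S) : ℝ := ∑ y, ∑ t, P s y t

/-- Marginal probability of the signal `T`. -/
def pT (P : S → Bool → T → ℝ) (t : T) : ℝ := ∑ s, ∑ y, P s y t

/-- Joint marginal on `(S,T)`. -/
def pST (P : S → Bool → T → ℝ) (s : S) (t : T) : ℝ := ∑ y, P s y t

/-- Joint marginal on `(Y,T)`. -/
def pYT (P : S → Bool → T → ℝ) (y : Bool) (t : T) : ℝ := ∑ s, P s y t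

/-- Joint marginal on `(S,Y)`. -/
def pSY (P : S → Bool → T → ℝ) (s : S) (y : Bool) : ℝ := ∑ t, P s y t

/-- An information structure: nonnegative, sums to one, every secret has positive
probability. -/
def InfoStructure (P : S → Bool → T → ℝ) : Prop :=
  (∀ s y t, 0 ≤ P s y t) ∧ (∑ s, ∑ y, ∑ t, P s y t) = 1 ∧ ∀ s, 0 < pS P s

/-- Conditional probability `P(T = t | S = s)`. -/
def condTS (P : S → Bool → T → ℝ) (t : T) (s : S) : ℝ := pST P s t / pS P s

/-- Conditional probability `P(S = s | T = t)`. -/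
def condST (P : S → Bool → T → ℝ) (s : S) (t : T) : ℝ := pST P s t / pT P t

/-- Posterior `P(Y = 1 | T = t)`. -/
def postYT (P : S → Bool → T → ℝ) (t : T) : ℝ := pYT P true t / pT P t

/-- Posterior `P(Y = 1 | S = s, T = t)`. -/
def postYST (P : S → Bool → T → ℝ) (s : S) (t : T) : ℝ := P s true t / pST P s t

/-- Prior conditional `P(Y = 1 | S = s)`. -/
def qS (P : S → Bool → T → ℝ) (s : S) : ℝ := pSY P s true / pS P s

/-- `ε`-inferential privacy. -/
def IsIP (ε : ℝ) (P : S → Bool → T → ℝ) : Prop :=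
  ∀ s₁ s₂ t, condTS P t s₁ ≤ Real.exp ε * condTS P t s₂

/-- Blackwell dominance via a row-stochastic garbling kernel. -/
def BlackwellDom {T₁ T₂ : Type} [Fintype T₁] [Fintype T₂]
    (Q₁ : Bool → T₁ → ℝ) (Q₂ : Bool → T₂ → ℝ) : Prop :=
  ∃ G : T₁ → T₂ → ℝ, (∀ a b, 0 ≤ G a b) ∧ (∀ a, ∑ b, G a b = 1) ∧
    ∀ y b, Q₂ y b = ∑ a, Q₁ y a * G a b

/-- `ε`-IP Blackwell optimality: no ε-IP information structure with the same
marginal on `(S,Y)` (over any finite signal set) strictly Blackwell dominates it. -/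
def BlackwellOptimal (ε : ℝ) (P : S → Bool → T → ℝ) : Prop :=
  InfoStructure P ∧ IsIP ε P ∧
  ¬ ∃ (n : ℕ) (P' : S → Bool → Fin n → ℝ),
      InfoStructure P' ∧ IsIP ε P' ∧ (∀ s y, pSY P' s y = pSY P s y) ∧
      BlackwellDom (pYT P') (pYT P) ∧ ¬ BlackwellDom (pYT P) (pYT P')

/-- Membership in `T̃`: signals with positive probability and nondegenerate posterior. -/
def inTildeT (P : S → Bool → T → ℝ) (t : T) : Prop :=
  0 < pT P t ∧ postYT P t ≠ 0 ∧ postYT P t ≠ 1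

/-- `L_t = min_s P(T=t|S=s)`. -/
def Lval [Nonempty S] (P : S → Bool → T → ℝ) (t : T) : ℝ :=
  Finset.univ.inf' Finset.univ_nonempty (fun s => condTS P t s)

/-- `H_t = max_s P(T=t|S=s)`. -/
def Hval [Nonempty S] (P : S → Bool → T → ℝ) (t : T) : ℝ :=
  Finset.univ.sup' Finset.univ_nonempty (fun s => condTS P t s)

/-- Expected utility `Σ_{t : P(T=t)>0} P(T=t)·u(P(Y=1|T=t))`. -/
def EU (P : S → Bool → T → ℝ) (u : ℝ → ℝ) : ℝ :=
  ∑ t ∈ Finset.univ.filter (fun t => 0 < pT P t), pT P t * u (postYT P t)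

end IPPaper

namespace IPPaper

set_option linter.unusedSectionVars false

section Blackwell

variable {T₁ T₂ T₃ : Type} [Fintype T₁] [Fintype T₂] [Fintype T₃]

theorem BlackwellDom.trans {Q₁ : Bool → T₁ → ℝ} {Q₂ : Bool → T₂ → ℝ} {Q₃ : Bool → T₃ → ℝ}
    (h₁₂ : BlackwellDom Q₁ Q₂) (h₂₃ : BlackwellDom Q₂ Q₃) : BlackwellDom Q₁ Q₃ := by
  obtain ⟨G, hG0, hG1, hG⟩ := h₁₂
  obtain ⟨K, hK0, hK1, hK⟩ := h₂₃
  refine ⟨fun a c => ∑ b, G a b * K b c,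
    fun a c => Finset.sum_nonneg fun b _ => mul_nonneg (hG0 a b) (hK0 b c), fun a => ?_,
    fun y c => ?_⟩
  · rw [Finset.sum_comm]
    simp_rw [← Finset.mul_sum, hK1, mul_one, hG1]
  · rw [hK]
    simp_rw [hG, Finset.sum_mul, Finset.mul_sum]
    rw [Finset.sum_comm]
    simp_rw [mul_assoc]

theorem blackwellDom_comp_equiv (Q : Bool → T₁ → ℝ) (e : T₂ ≃ T₁) :
    BlackwellDom Q (fun y b => Q y (e b)) := by
  refine ⟨fun a b => if a = e b then 1 else 0, fun a b => ?_, fun a => ?_, fun y b => ?_⟩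
  · positivity
  · rw [← e.symm.sum_comp]
    simp
  · simp

theorem blackwellDom_of_comp_equiv (Q : Bool → T₁ → ℝ) (e : T₂ ≃ T₁) :
    BlackwellDom (fun y b => Q y (e b)) Q := by
  simpa using blackwellDom_comp_equiv (fun y b => Q y (e b)) e.symm

theorem BlackwellDom.sum_abs_le {Q₁ : Bool → T₁ → ℝ} {Q₂ : Bool → T₂ → ℝ}
    (h : BlackwellDom Q₁ Q₂) (α β : ℝ) :
    ∑ b, |α * Q₂ true b + β * Q₂ false b| ≤ ∑ a, |α * Q₁ true a + β * Q₁ false a| := by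
  obtain ⟨G, hG0, hG1, hG⟩ := h
  calc ∑ b, |α * Q₂ true b + β * Q₂ false b|
      = ∑ b, |∑ a, (α * Q₁ true a + β * Q₁ false a) * G a b| := by
        refine Finset.sum_congr rfl fun b _ => ?_
        rw [hG, hG, Finset.mul_sum, Finset.mul_sum, ← Finset.sum_add_distrib]
        exact congrArg _ (Finset.sum_congr rfl fun a _ => by ring)
    _ ≤ ∑ b, ∑ a, |α * Q₁ true a + β * Q₁ false a| * G a b := by
        refine Finset.sum_le_sum fun b _ => (Finset.abs_sum_le_sum_abs _ _).trans_eq ?_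
        exact Finset.sum_congr rfl fun a _ => by rw [abs_mul, abs_of_nonneg (hG0 a b)]
    _ = ∑ a, |α * Q₁ true a + β * Q₁ false a| := by
        rw [Finset.sum_comm]
        simp_rw [← Finset.mul_sum, hG1, mul_one]

end Blackwell

section Marginals

variable {S T : Type} [Fintype S] [Fintype T]

theorem pS_eq_sum_pSY (P : S → Bool → T → ℝ) (s : S) : pS P s = ∑ y, pSY P s y := rfl

theorem pT_eq_add (P : S → Bool → T → ℝ) (t : T) :
    pT P t = pYT P true t + pYT P false t := by
  simp [pT, pYT, Finset.sum_add_distrib]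

theorem pS_congr {T' : Type} [Fintype T'] {P : S → Bool → T → ℝ} {P' : S → Bool → T' → ℝ}
    (h : ∀ s y, pSY P' s y = pSY P s y) : pS P' = pS P := by
  funext s
  simp_rw [pS_eq_sum_pSY, h]

theorem InfoStructure.of_pSY_eq {T' : Type} [Fintype T'] {P : S → Bool → T → ℝ}
    {P' : S → Bool → T' → ℝ} (hP : InfoStructure P) (h0 : ∀ s y t, 0 ≤ P' s y t)
    (h : ∀ s y, pSY P' s y = pSY P s y) : InfoStructure P' := by
  refine ⟨h0, ?_, fun s => pS_congr h ▸ hP.2.2 s⟩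
  rw [← hP.2.1]
  exact Finset.sum_congr rfl fun s _ => Finset.sum_congr rfl fun y _ => h s y

theorem pYT_nonneg {P : S → Bool → T → ℝ} (hP : InfoStructure P) (y : Bool) (t : T) :
    0 ≤ pYT P y t := Finset.sum_nonneg fun s _ => hP.1 s y t

theorem condTS_nonneg {P : S → Bool → T → ℝ} (hP : InfoStructure P) (t : T) (s : S) :
    0 ≤ condTS P t s :=
  div_nonneg (Finset.sum_nonneg fun y _ => hP.1 s y t) (hP.2.2 s).le

theorem condTS_pos {ε : ℝ} {P : S → Bool → T → ℝ} (hP : InfoStructure P) (hIP : IsIP ε P)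
    {t : T} (ht : 0 < pT P t) (s : S) : 0 < condTS P t s := by
  refine (condTS_nonneg hP t s).lt_of_ne fun h0 => ht.ne' ?_
  refine Finset.sum_eq_zero fun s' _ => ?_
  have h1 : condTS P t s' ≤ 0 := by simpa [← h0] using hIP s' s t
  have h2 := le_antisymm h1 (condTS_nonneg hP t s')
  exact (div_eq_zero_iff.1 h2).resolve_right (hP.2.2 s').ne'

theorem pST_pos {ε : ℝ} {P : S → Bool → T → ℝ} (hP : InfoStructure P) (hIP : IsIP ε P)
    {t : T} (ht : 0 < pT P t) (s : S) : 0 < P s true t + P s false t := by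
  have h := (div_pos_iff_of_pos_right (hP.2.2 s)).1 (condTS_pos hP hIP ht s)
  simpa [pST] using h

/-- Optimality excludes improvements over an arbitrary finite signal type. -/
theorem BlackwellOptimal.dom_of_dom {ε : ℝ} {P : S → Bool → T → ℝ} (h : BlackwellOptimal ε P)
    {T' : Type} [Fintype T'] {P' : S → Bool → T' → ℝ} (hP' : InfoStructure P')
    (hIP : IsIP ε P') (hm : ∀ s y, pSY P' s y = pSY P s y)
    (hd : BlackwellDom (pYT P') (pYT P)) : BlackwellDom (pYT P) (pYT P') := by
  by_contra hn
  let e := (Fintype.equivFin T').symm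
  let R : S → Bool → Fin (Fintype.card T') → ℝ := fun s y i => P' s y (e i)
  have hR : ∀ s y, pSY R s y = pSY P' s y := fun s y => e.sum_comp (P' s y)
  have hpS := pS_congr hR
  refine h.2.2 ⟨_, R, hP'.of_pSY_eq (fun s y i => hP'.1 s y _) hR, fun s₁ s₂ i => ?_,
    fun s y => (hR s y).trans (hm s y), ?_, fun hc => hn ?_⟩
  · have := hIP s₁ s₂ (e i)
    simp only [condTS, hpS] at this ⊢
    exact this
  · exact (blackwellDom_of_comp_equiv (pYT P') e).trans hd
  · exact hc.trans (blackwellDom_of_comp_equiv (pYT P') e)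

end Marginals

section Transfer

variable {S T : Type} [Fintype S] [Fintype T]

/-- Take half of each of the signals `t` and `t'`, and move the (signed) mass `D` from the first
half, which becomes `inr false`, to the second, which becomes `inr true`. -/
def transfer (P : S → Bool → T → ℝ) (t t' : T) (D : S → Bool → ℝ) :
    S → Bool → T ⊕ Bool → ℝ := fun s y =>
  Sum.elim (fun r => P s y r * (1 - (if r = t then 1 / 2 else 0) - (if r = t' then 1 / 2 else 0)))
    (fun b => if b then P s y t' / 2 + D s y else P s y t / 2 - D s y)

theorem sum_mul_transfer_weight (f : T → ℝ) (t t' : T) :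
    ∑ r, f r * (1 - (if r = t then 1 / 2 else 0) - (if r = t' then 1 / 2 else 0))
      = ∑ r, f r - f t / 2 - f t' / 2 := by
  simp [mul_sub, Finset.sum_sub_distrib, div_eq_mul_inv]

theorem transfer_weight_nonneg (r t t' : T) :
    (0 : ℝ) ≤ 1 - (if r = t then 1 / 2 else 0) - (if r = t' then 1 / 2 else 0) := by
  split_ifs <;> norm_num

theorem pSY_transfer (P : S → Bool → T → ℝ) (t t' : T) (D : S → Bool → ℝ) (s : S) (y : Bool) :
    pSY (transfer P t t' D) s y = pSY P s y := by
  simp only [pSY, transfer, Fintype.sum_sum_type, Sum.elim_inl, Sum.elim_inr, Fintype.sum_bool,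
    sum_mul_transfer_weight]
  simp only [if_true, Bool.false_eq_true, if_false]
  ring

theorem pYT_transfer_inl (P : S → Bool → T → ℝ) (t t' : T) (D : S → Bool → ℝ) (y : Bool) (r : T) :
    pYT (transfer P t t' D) y (Sum.inl r) = pYT P y r *
      (1 - (if r = t then 1 / 2 else 0) - (if r = t' then 1 / 2 else 0)) := by
  simp only [pYT, transfer, Sum.elim_inl, Finset.sum_mul]

theorem pYT_transfer_true (P : S → Bool → T → ℝ) (t t' : T) (D : S → Bool → ℝ) (y : Bool) :
    pYT (transfer P t t' D) y (Sum.inr true) = pYT P y t' / 2 + ∑ s, D s y := by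
  simp [pYT, transfer, Finset.sum_add_distrib, Finset.sum_div]

theorem pYT_transfer_false (P : S → Bool → T → ℝ) (t t' : T) (D : S → Bool → ℝ) (y : Bool) :
    pYT (transfer P t t' D) y (Sum.inr false) = pYT P y t / 2 - ∑ s, D s y := by
  simp [pYT, transfer, Finset.sum_sub_distrib, Finset.sum_div]

theorem blackwellDom_transfer {P : S → Bool → T → ℝ} (hP : InfoStructure P) {t t' : T}
    {D : S → Bool → ℝ}
    (hle : pYT P true t * pYT P false t' ≤ pYT P true t' * pYT P false t)
    (h1 : 0 ≤ ∑ s, D s true) (h0 : ∑ s, D s false ≤ 0)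
    (hpos : 0 < (∑ s, D s true) * (pYT P false t + pYT P false t')
      - (∑ s, D s false) * (pYT P true t + pYT P true t')) :
    BlackwellDom (pYT (transfer P t t' D)) (pYT P) := by
  have hA1 := pYT_nonneg hP true t
  have hA0 := pYT_nonneg hP false t
  have hB1 := pYT_nonneg hP true t'
  have hB0 := pYT_nonneg hP false t'
  have hT := pYT_transfer_true P t t' D
  have hF := pYT_transfer_false P t t' D
  generalize hd1 : ∑ s, D s true = d1 at *
  generalize hd0 : ∑ s, D s false = d0 at *
  set A1 := pYT P true t with hA1d
  set A0 := pYT P false t with hA0d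
  set B1 := pYT P true t' with hB1d
  set B0 := pYT P false t' with hB0d
  have hdA : 0 ≤ (d1 * A0 - d0 * A1) / 2 := by
    nlinarith [mul_nonneg h1 hA0, mul_nonneg (neg_nonneg.2 h0) hA1]
  have hdB : 0 ≤ (d1 * B0 - d0 * B1) / 2 := by
    nlinarith [mul_nonneg h1 hB0, mul_nonneg (neg_nonneg.2 h0) hB1]
  set Δ := (B1 * A0 - B0 * A1) / 4 + (d1 * A0 - d0 * A1) / 2 + (d1 * B0 - d0 * B1) / 2 with hΔd
  have hΔ : 0 < Δ := by rw [hΔd]; nlinarith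
  obtain ⟨l, hl0, hl1, hl⟩ : ∃ l : ℝ, 0 ≤ l ∧ l ≤ 1 ∧
      l * Δ = (B1 * A0 - B0 * A1) / 4 + (d1 * A0 - d0 * A1) / 2 :=
    ⟨((B1 * A0 - B0 * A1) / 4 + (d1 * A0 - d0 * A1) / 2) / Δ,
      div_nonneg (by nlinarith) hΔ.le, (div_le_one hΔ).2 (by rw [hΔd]; linarith),
      div_mul_cancel₀ _ hΔ.ne'⟩
  obtain ⟨m, hm0, hm1, hm⟩ : ∃ m : ℝ, 0 ≤ m ∧ m ≤ 1 ∧ m * Δ = (d1 * A0 - d0 * A1) / 2 :=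
    ⟨((d1 * A0 - d0 * A1) / 2) / Δ,
      div_nonneg hdA hΔ.le, (div_le_one hΔ).2 (by rw [hΔd]; nlinarith),
      div_mul_cancel₀ _ hΔ.ne'⟩
  have key : ∀ y, l * (pYT P y t / 2 - ∑ s, D s y) + m * (pYT P y t' / 2 + ∑ s, D s y)
      = pYT P y t / 2 := by
    intro y
    refine mul_right_cancel₀ hΔ.ne' ?_
    cases y
    · rw [hd0, ← hA0d, ← hB0d]
      linear_combination (A0 / 2 - d0) * hl + (B0 / 2 + d0) * hm + (A0 / 2) * (hΔd.symm)
    · rw [hd1, ← hA1d, ← hB1d]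
      linear_combination (A1 / 2 - d1) * hl + (B1 / 2 + d1) * hm + (A1 / 2) * (hΔd.symm)
  refine ⟨Sum.elim (fun r b => if b = r then 1 else 0)
    (fun c b => if c then (if b = t then m else 0) + (if b = t' then 1 - m else 0)
      else (if b = t then l else 0) + (if b = t' then 1 - l else 0)), ?_, ?_, ?_⟩
  · rintro (r | _ | _) b
    · simp only [Sum.elim_inl]; split_ifs <;> norm_num
    · simp only [Sum.elim_inr]; split_ifs <;> simp_all
    · simp only [Sum.elim_inr]; split_ifs <;> simp_all
  · rintro (r | _ | _) <;> simp [Finset.sum_add_distrib]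
  · intro y b
    rw [Fintype.sum_sum_type, Fintype.sum_bool, hT, hF]
    simp only [pYT_transfer_inl, Sum.elim_inl, Sum.elim_inr, mul_ite, mul_one, mul_zero,
      Finset.sum_ite_eq, Finset.mem_univ, if_true, Bool.false_eq_true, if_false]
    have hk := key y
    split_ifs with ht ht' ht'
    · subst ht; subst ht'; ring
    · subst ht; linear_combination -hk
    · subst ht'; linear_combination hk
    · ring

theorem not_blackwellDom_transfer {P : S → Bool → T → ℝ} {t t' : T} {D : S → Bool → ℝ}
    (hle : pYT P true t * pYT P false t' ≤ pYT P true t' * pYT P false t)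
    (hpos : 0 < (∑ s, D s true) * (pYT P false t + pYT P false t')
      - (∑ s, D s false) * (pYT P true t + pYT P true t')) :
    ¬ BlackwellDom (pYT P) (pYT (transfer P t t' D)) := by
  intro h
  have h' := h.sum_abs_le (pYT P false t + pYT P false t') (-(pYT P true t + pYT P true t'))
  rw [Fintype.sum_sum_type, Fintype.sum_bool] at h'
  simp only [pYT_transfer_true, pYT_transfer_false, pYT_transfer_inl] at h'
  have hw : ∀ r, |(pYT P false t + pYT P false t') * (pYT P true r *
        (1 - (if r = t then 1 / 2 else 0) - (if r = t' then 1 / 2 else 0))) +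
        -(pYT P true t + pYT P true t') * (pYT P false r *
        (1 - (if r = t then 1 / 2 else 0) - (if r = t' then 1 / 2 else 0)))| =
      |(pYT P false t + pYT P false t') * pYT P true r +
        -(pYT P true t + pYT P true t') * pYT P false r| *
        (1 - (if r = t then 1 / 2 else 0) - (if r = t' then 1 / 2 else 0)) := by
    intro r
    rw [← abs_of_nonneg (transfer_weight_nonneg r t t'), ← abs_mul,
      abs_of_nonneg (transfer_weight_nonneg r t t')]
    congr 1
    ring
  simp_rw [hw] at h'
  rw [sum_mul_transfer_weight (fun r => |(pYT P false t + pYT P false t') * pYT P true r +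
        -(pYT P true t + pYT P true t') * pYT P false r|)] at h'
  generalize ∑ s, D s true = d1 at *
  generalize ∑ s, D s false = d0 at *
  generalize pYT P true t = A1 at *
  generalize pYT P false t = A0 at *
  generalize pYT P true t' = B1 at *
  generalize pYT P false t' = B0 at *
  rw [abs_of_nonpos (a := (A0 + B0) * A1 + -(A1 + B1) * A0) (by nlinarith),
    abs_of_nonneg (a := (A0 + B0) * B1 + -(A1 + B1) * B0) (by nlinarith)] at h'
  nlinarith [le_abs_self ((A0 + B0) * (B1 / 2 + d1) + -(A1 + B1) * (B0 / 2 + d0)),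
    neg_abs_le ((A0 + B0) * (A1 / 2 - d1) + -(A1 + B1) * (A0 / 2 - d0))]

theorem isIP_transfer {ε : ℝ} {P : S → Bool → T → ℝ} (hIP : IsIP ε P)
    {t t' : T} {D : S → Bool → ℝ}
    (hF : ∀ s₁ s₂, (∑ y, (P s₁ y t / 2 - D s₁ y)) / pS P s₁
      ≤ Real.exp ε * ((∑ y, (P s₂ y t / 2 - D s₂ y)) / pS P s₂))
    (hT : ∀ s₁ s₂, (∑ y, (P s₁ y t' / 2 + D s₁ y)) / pS P s₁
      ≤ Real.exp ε * ((∑ y, (P s₂ y t' / 2 + D s₂ y)) / pS P s₂)) :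
    IsIP ε (transfer P t t' D) := by
  have hpS := pS_congr (pSY_transfer P t t' D)
  rintro s₁ s₂ (r | _ | _)
  · have h := mul_le_mul_of_nonneg_right (hIP s₁ s₂ r) (transfer_weight_nonneg r t t')
    simp only [condTS, hpS, pST, transfer, Sum.elim_inl, ← Finset.sum_mul] at h ⊢
    simpa only [mul_div_right_comm, ← mul_assoc] using h
  · simpa only [condTS, hpS, pST, transfer, Sum.elim_inr, Bool.false_eq_true, if_false]
      using hF s₁ s₂
  · simpa only [condTS, hpS, pST, transfer, Sum.elim_inr, if_true] using hT s₁ s₂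

open Filter Topology in
theorem eventually_nonneg_affine {a b : ℝ} (h : 0 < a ∨ 0 ≤ a ∧ 0 ≤ b) :
    ∀ᶠ δ in 𝓝[>] (0 : ℝ), 0 ≤ a + δ * b := by
  rcases h with h | ⟨h, hb⟩
  · have hc : Tendsto (fun δ : ℝ => a + δ * b) (𝓝[>] 0) (𝓝 (a + 0 * b)) :=
      ((by fun_prop : Continuous fun δ : ℝ => a + δ * b).tendsto 0).mono_left nhdsWithin_le_nhds
    exact (hc.eventually_const_lt (by simpa using h)).mono fun _ h => h.le
  · filter_upwards [self_mem_nhdsWithin] with δ hδ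
    have : (0 : ℝ) < δ := hδ
    positivity

open Filter Topology in
/-- If the signal `t'` is at least as favourable to `Y = 1` as `t`, then an optimal structure
admits no feasible direction `D` moving mass on `Y = 1` from `t` to `t'` and mass on `Y = 0`
from `t'` to `t`. -/
theorem BlackwellOptimal.no_feasible_direction {ε : ℝ} {P : S → Bool → T → ℝ}
    (h : BlackwellOptimal ε P) {t t' : T} {D : S → Bool → ℝ}
    (hle : pYT P true t * pYT P false t' ≤ pYT P true t' * pYT P false t)
    (h1 : 0 ≤ ∑ s, D s true) (h0 : ∑ s, D s false ≤ 0)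
    (hpos : 0 < (∑ s, D s true) * (pYT P false t + pYT P false t')
      - (∑ s, D s false) * (pYT P true t + pYT P true t'))
    (hF : ∀ s y, 0 < P s y t ∨ D s y ≤ 0) (hT : ∀ s y, 0 < P s y t' ∨ 0 ≤ D s y)
    (hFc : ∀ s₁ s₂, condTS P t s₁ < Real.exp ε * condTS P t s₂ ∨
      Real.exp ε * ((∑ y, D s₂ y) / pS P s₂) ≤ (∑ y, D s₁ y) / pS P s₁)
    (hTc : ∀ s₁ s₂, condTS P t' s₁ < Real.exp ε * condTS P t' s₂ ∨
      (∑ y, D s₁ y) / pS P s₁ ≤ Real.exp ε * ((∑ y, D s₂ y) / pS P s₂)) : False := by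
  obtain ⟨hP, hIP, -⟩ := id h
  have e1 : ∀ᶠ δ in 𝓝[>] (0 : ℝ), ∀ s y, 0 ≤ P s y t / 2 + δ * -D s y :=
    eventually_all.2 fun s => eventually_all.2 fun y => eventually_nonneg_affine <| by
      rcases hF s y with h | h
      · left; positivity
      · exact Or.inr ⟨by linarith [hP.1 s y t], by linarith⟩
  have e2 : ∀ᶠ δ in 𝓝[>] (0 : ℝ), ∀ s y, 0 ≤ P s y t' / 2 + δ * D s y :=
    eventually_all.2 fun s => eventually_all.2 fun y => eventually_nonneg_affine <| by
      rcases hT s y with h | h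
      · left; positivity
      · exact Or.inr ⟨by linarith [hP.1 s y t'], by linarith⟩
  have e3 : ∀ᶠ δ in 𝓝[>] (0 : ℝ), ∀ s₁ s₂,
      0 ≤ (Real.exp ε * condTS P t s₂ - condTS P t s₁) / 2 +
        δ * ((∑ y, D s₁ y) / pS P s₁ - Real.exp ε * ((∑ y, D s₂ y) / pS P s₂)) :=
    eventually_all.2 fun s₁ => eventually_all.2 fun s₂ => eventually_nonneg_affine <| by
      rcases hFc s₁ s₂ with h | h
      · left; linarith
      · exact Or.inr ⟨by linarith [hIP s₁ s₂ t], by linarith⟩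
  have e4 : ∀ᶠ δ in 𝓝[>] (0 : ℝ), ∀ s₁ s₂,
      0 ≤ (Real.exp ε * condTS P t' s₂ - condTS P t' s₁) / 2 +
        δ * (Real.exp ε * ((∑ y, D s₂ y) / pS P s₂) - (∑ y, D s₁ y) / pS P s₁) :=
    eventually_all.2 fun s₁ => eventually_all.2 fun s₂ => eventually_nonneg_affine <| by
      rcases hTc s₁ s₂ with h | h
      · left; linarith
      · exact Or.inr ⟨by linarith [hIP s₁ s₂ t'], by linarith⟩
  have e5 : ∀ᶠ δ in 𝓝[>] (0 : ℝ), 0 < δ := self_mem_nhdsWithin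
  obtain ⟨δ, h1', h2', h3', h4', hδ⟩ := (e1.and (e2.and (e3.and (e4.and e5)))).exists
  have hs : ∀ y, ∑ s, δ * D s y = δ * ∑ s, D s y := fun y => (Finset.mul_sum _ _ _).symm
  have hpos' : 0 < (∑ s, δ * D s true) * (pYT P false t + pYT P false t')
      - (∑ s, δ * D s false) * (pYT P true t + pYT P true t') := by
    rw [hs, hs]
    nlinarith [mul_pos hδ hpos]
  have hm := pSY_transfer P t t' (fun s y => δ * D s y)
  refine not_blackwellDom_transfer (D := fun s y => δ * D s y) hle hpos' (h.dom_of_dom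
    (hP.of_pSY_eq ?_ hm) (isIP_transfer hIP ?_ ?_) hm (blackwellDom_transfer hP hle ?_ ?_ hpos'))
  · rintro s y (r | _ | _)
    · exact mul_nonneg (hP.1 s y r) (transfer_weight_nonneg r t t')
    · simpa [transfer] using h1' s y
    · simpa [transfer] using h2' s y
  · intro s₁ s₂
    have := h3' s₁ s₂
    simp only [condTS, pST, Fintype.sum_bool] at this ⊢
    rw [← sub_nonneg]
    refine this.trans_eq ?_
    ring
  · intro s₁ s₂
    have := h4' s₁ s₂
    simp only [condTS, pST, Fintype.sum_bool] at this ⊢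
    rw [← sub_nonneg]
    refine this.trans_eq ?_
    ring
  · rw [hs]; positivity
  · rw [hs]; exact mul_nonpos_of_nonneg_of_nonpos hδ.le h0

end Transfer

section Structure

variable {S T : Type} [Fintype S] [Fintype T]

/-- `P(T=t|S=s)` is as large as privacy permits. -/
def IsHigh (ε : ℝ) (P : S → Bool → T → ℝ) (t : T) (s : S) : Prop :=
  ∃ s', condTS P t s = Real.exp ε * condTS P t s'

/-- `P(T=t|S=s)` is as small as privacy permits. -/
def IsLow (ε : ℝ) (P : S → Bool → T → ℝ) (t : T) (s : S) : Prop :=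
  ∃ s', condTS P t s' = Real.exp ε * condTS P t s

variable {ε : ℝ} {P : S → Bool → T → ℝ} {t t' : T}

theorem IsHigh.not_isLow (hε : 0 < ε) (hP : InfoStructure P) (hIP : IsIP ε P)
    (ht : 0 < pT P t) {s : S} (h : IsHigh ε P t s) : ¬ IsLow ε P t s := by
  rintro ⟨s₁, h₁⟩
  obtain ⟨s₂, h₂⟩ := h
  have hlt : 1 < Real.exp ε := Real.one_lt_exp_iff.2 hε
  have h₃ := hIP s₁ s₂ t
  have h₄ := condTS_pos hP hIP ht s
  nlinarith

theorem IsHigh.condTS_eq (hIP : IsIP ε P) {s₁ s₂ : S} (h₁ : IsHigh ε P t s₁)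
    (h₂ : IsHigh ε P t s₂) : condTS P t s₁ = condTS P t s₂ := by
  obtain ⟨a, ha⟩ := h₁
  obtain ⟨b, hb⟩ := h₂
  exact le_antisymm (hb ▸ hIP s₁ b t) (ha ▸ hIP s₂ a t)

theorem IsLow.condTS_eq (hIP : IsIP ε P) {s₁ s₂ : S} (h₁ : IsLow ε P t s₁)
    (h₂ : IsLow ε P t s₂) : condTS P t s₁ = condTS P t s₂ := by
  obtain ⟨a, ha⟩ := h₁
  obtain ⟨b, hb⟩ := h₂
  have hε := Real.exp_pos ε
  refine le_antisymm ?_ ?_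
  · exact le_of_mul_le_mul_left (ha ▸ hIP a s₂ t) hε
  · exact le_of_mul_le_mul_left (hb ▸ hIP b s₁ t) hε

theorem IsLow.condTS_eq_of_isHigh (hIP : IsIP ε P) {s₁ s₂ : S} (h₁ : IsLow ε P t s₁)
    (h₂ : IsHigh ε P t s₂) : condTS P t s₂ = Real.exp ε * condTS P t s₁ := by
  obtain ⟨a, ha⟩ := h₁
  rw [← ha]
  exact h₂.condTS_eq hIP ⟨s₁, ha⟩

theorem BlackwellOptimal.eq_zero_of_le (h : BlackwellOptimal ε P) (ht : 0 < pT P t)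
    (hle : pYT P true t * pYT P false t' ≤ pYT P true t' * pYT P false t) {s : S}
    (hs : 0 < P s true t) : P s false t' = 0 := by
  by_contra hne
  have hs' : 0 < P s false t' := (h.1.1 s false t').lt_of_ne' hne
  have hz : ∀ r, ∑ y : Bool, (if r = s then (if y then (1 : ℝ) else -1) else 0) = 0 := by
    intro r
    split_ifs <;> simp
  refine h.no_feasible_direction (D := fun r y => if r = s then (if y then 1 else -1) else 0)
    hle ?_ ?_ ?_ ?_ ?_ (fun r₁ r₂ => Or.inr ?_) (fun r₁ r₂ => Or.inr ?_)
  · simp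
  · simp
  · have := pT_eq_add P t
    simp
    linarith [pYT_nonneg h.1 true t', pYT_nonneg h.1 false t']
  · intro r y
    by_cases hr : r = s
    · subst hr; cases y <;> simp [hs]
    · simp [hr]
  · intro r y
    by_cases hr : r = s
    · subst hr; cases y <;> simp [hs']
    · simp [hr]
  · simp only [hz]; simp
  · simp only [hz]; simp

theorem IsIP.lt_of_not_isLow (hIP : IsIP ε P) {s : S} (h : ¬ IsLow ε P t s) (r : S) :
    condTS P t r < Real.exp ε * condTS P t s :=
  (hIP r s t).lt_of_ne fun he => h ⟨r, he⟩

theorem IsIP.lt_of_not_isHigh (hIP : IsIP ε P) {s : S} (h : ¬ IsHigh ε P t s) (r : S) :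
    condTS P t s < Real.exp ε * condTS P t r :=
  (hIP s r t).lt_of_ne fun he => h ⟨r, he⟩

theorem BlackwellOptimal.isLow_or_isHigh_of_true (h : BlackwellOptimal ε P)
    (hle : pYT P true t * pYT P false t' ≤ pYT P true t' * pYT P false t)
    (hA : 0 < pYT P false t) {s : S} (hs : 0 < P s true t) :
    IsLow ε P t s ∨ IsHigh ε P t' s := by
  by_contra! hn
  have hp := h.1.2.2
  have hD : ∀ r, 0 ≤ ∑ y : Bool, (if r = s ∧ y = true then (1 : ℝ) else 0) := fun r =>
    Finset.sum_nonneg fun y _ => by positivity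
  have hD0 : ∀ r, r ≠ s → ∑ y : Bool, (if r = s ∧ y = true then (1 : ℝ) else 0) = 0 := by
    intro r hr
    simp [hr]
  refine h.no_feasible_direction (D := fun r y => if r = s ∧ y = true then 1 else 0)
    hle ?_ ?_ ?_ ?_ ?_ (fun r₁ r₂ => ?_) (fun r₁ r₂ => ?_)
  · simp
  · simp
  · simp
    linarith [pYT_nonneg h.1 false t']
  · intro r y
    by_cases hr : r = s ∧ y = true
    · obtain ⟨rfl, rfl⟩ := hr; simp [hs]
    · simp [hr]
  · intro r y
    right
    positivity
  · by_cases hr : r₂ = s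
    · subst hr; exact Or.inl (h.2.1.lt_of_not_isLow hn.1 r₁)
    · right
      rw [hD0 r₂ hr]
      simpa using div_nonneg (hD r₁) (hp r₁).le
  · by_cases hr : r₁ = s
    · subst hr; exact Or.inl (h.2.1.lt_of_not_isHigh hn.2 r₂)
    · right
      rw [hD0 r₁ hr]
      simpa using mul_nonneg (Real.exp_pos ε).le (div_nonneg (hD r₂) (hp r₂).le)

theorem BlackwellOptimal.isLow_or_isHigh_of_false (h : BlackwellOptimal ε P)
    (hle : pYT P true t * pYT P false t' ≤ pYT P true t' * pYT P false t)
    (hB : 0 < pYT P true t') {s : S} (hs : 0 < P s false t') :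
    IsLow ε P t' s ∨ IsHigh ε P t s := by
  by_contra! hn
  have hp := h.1.2.2
  have hD : ∀ r, ∑ y : Bool, (if r = s ∧ y = false then (-1 : ℝ) else 0) ≤ 0 := fun r =>
    Finset.sum_nonpos fun y _ => by split_ifs <;> norm_num
  have hD0 : ∀ r, r ≠ s → ∑ y : Bool, (if r = s ∧ y = false then (-1 : ℝ) else 0) = 0 := by
    intro r hr
    simp [hr]
  refine h.no_feasible_direction (D := fun r y => if r = s ∧ y = false then -1 else 0)
    hle ?_ ?_ ?_ ?_ ?_ (fun r₁ r₂ => ?_) (fun r₁ r₂ => ?_)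
  · simp
  · simp
  · simp
    linarith [pYT_nonneg h.1 true t]
  · intro r y
    right
    split_ifs <;> norm_num
  · intro r y
    by_cases hr : r = s ∧ y = false
    · obtain ⟨rfl, rfl⟩ := hr; simp [hs]
    · simp [hr]
  · by_cases hr : r₁ = s
    · subst hr; exact Or.inl (h.2.1.lt_of_not_isHigh hn.2 r₂)
    · right
      rw [hD0 r₁ hr]
      simpa using mul_nonpos_of_nonneg_of_nonpos (Real.exp_pos ε).le
        (div_nonpos_of_nonpos_of_nonneg (hD r₂) (hp r₂).le)
  · by_cases hr : r₂ = s
    · subst hr; exact Or.inl (h.2.1.lt_of_not_isLow hn.1 r₁)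
    · right
      rw [hD0 r₂ hr]
      simpa using div_nonpos_of_nonpos_of_nonneg (hD r₁) (hp r₁).le

/-- The level of the secret `s` at the signal `t`: as `P(Y=1|T=t)` increases, an optimal signal
passes through the levels `Y=0` and high, `Y=0` and low, `Y=1` and low, `Y=1` and high. -/
def level (ε : ℝ) (P : S → Bool → T → ℝ) (t : T) (s : S) : ℕ :=
  if pYT P true t = 0 then 0
  else if pYT P false t = 0 then 3
  else if 0 < P s true t then (if IsHigh ε P t s then 3 else 2)
  else if IsHigh ε P t s then 0 else 1

theorem level_le_three (ε : ℝ) (P : S → Bool → T → ℝ) (t : T) (s : S) : level ε P t s ≤ 3 := by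
  unfold level
  split_ifs <;> norm_num

theorem BlackwellOptimal.level_mono (hε : 0 < ε) (h : BlackwellOptimal ε P)
    (ht : 0 < pT P t) (ht' : 0 < pT P t')
    (hle : pYT P true t * pYT P false t' ≤ pYT P true t' * pYT P false t) (s : S) :
    level ε P t s ≤ level ε P t' s := by
  have hP := h.1
  have hIP := h.2.1
  have a := pT_eq_add P t
  have a' := pT_eq_add P t'
  by_cases hA1 : pYT P true t = 0
  · simp [level, hA1]
  by_cases hB0 : pYT P false t' = 0
  · have : pYT P true t' ≠ 0 := fun h0 => by rw [h0, hB0] at a'; linarith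
    simpa [level, hB0, this] using level_le_three ε P t s
  have hA1' := (pYT_nonneg hP true t).lt_of_ne' hA1
  have hB0' := (pYT_nonneg hP false t').lt_of_ne' hB0
  have hprod := (mul_pos hA1' hB0').trans_le hle
  have hB1' : 0 < pYT P true t' := pos_of_mul_pos_left hprod (pYT_nonneg hP false t)
  have hA0' : 0 < pYT P false t := pos_of_mul_pos_right hprod (pYT_nonneg hP true t')
  simp only [level, hA1, hB0, hA0'.ne', hB1'.ne', if_false]
  by_cases hs : 0 < P s true t
  · have h0 := h.eq_zero_of_le ht hle hs
    have h1 : 0 < P s true t' := by linarith [pST_pos hP hIP ht' s]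
    by_cases hh : IsHigh ε P t s
    · have := (h.isLow_or_isHigh_of_true hle hA0' hs).resolve_left
        (hh.not_isLow hε hP hIP ht)
      simp [hs, h1, this, hh]
    · simp only [hs, h1, hh, if_true, if_false]
      split_ifs <;> norm_num
  · by_cases h1 : 0 < P s true t'
    · simp only [hs, h1, if_true, if_false]
      split_ifs <;> norm_num
    · have h2 : 0 < P s false t' := by linarith [pST_pos hP hIP ht' s]
      by_cases hh : IsHigh ε P t' s
      · have := (h.isLow_or_isHigh_of_false hle hB1' h2).resolve_left
          (hh.not_isLow hε hP hIP ht')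
        simp [hs, h1, this, hh]
      · simp only [hs, h1, hh, if_false]
        split_ifs <;> norm_num

theorem exists_pos_of_pYT_pos {y : Bool} (h : 0 < pYT P y t) : ∃ s, 0 < P s y t := by
  obtain ⟨s, -, hs⟩ := Finset.exists_lt_of_sum_lt (s := Finset.univ) (f := fun _ => (0 : ℝ))
    (g := fun s => P s y t) (by simpa [pYT] using h)
  exact ⟨s, hs⟩

theorem BlackwellOptimal.isLow_or_isHigh (h : BlackwellOptimal ε P) (ht : 0 < pT P t)
    (h1 : 0 < pYT P true t) (h0 : 0 < pYT P false t) (s : S) :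
    IsLow ε P t s ∨ IsHigh ε P t s := by
  by_cases hs : 0 < P s true t
  · exact h.isLow_or_isHigh_of_true le_rfl h0 hs
  · exact h.isLow_or_isHigh_of_false le_rfl h1 (by linarith [pST_pos h.1 h.2.1 ht s])

theorem BlackwellOptimal.two_le_level_iff (h : BlackwellOptimal ε P) (s : S)
    (h0 : pYT P false t ≠ 0) : 2 ≤ level ε P t s ↔ 0 < P s true t := by
  by_cases h1 : pYT P true t = 0
  · have : P s true t = 0 :=
      (Finset.sum_eq_zero_iff_of_nonneg fun r _ => h.1.1 r true t).1 h1 s (Finset.mem_univ s)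
    simp [level, h1, this]
  · simp only [level, h1, h0, if_false]
    split_ifs <;> simp_all

theorem BlackwellOptimal.cross_eq_of_level_eq (h : BlackwellOptimal ε P)
    (ht : 0 < pT P t) (ht' : 0 < pT P t')
    (hle : pYT P true t * pYT P false t' ≤ pYT P true t' * pYT P false t)
    (hlev : ∀ s, level ε P t s = level ε P t' s) :
    pYT P true t * pYT P false t' = pYT P true t' * pYT P false t := by
  have hP := h.1
  have hIP := h.2.1
  have a := pT_eq_add P t
  have a' := pT_eq_add P t'
  by_cases hB1 : pYT P true t' = 0
  · have := pYT_nonneg hP true t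
    have := pYT_nonneg hP false t'
    rw [hB1] at hle ⊢
    rw [zero_mul] at hle ⊢
    exact le_antisymm hle (by positivity)
  by_cases hA0 : pYT P false t = 0
  · have := pYT_nonneg hP true t
    have := pYT_nonneg hP false t'
    rw [hA0] at hle ⊢
    rw [mul_zero] at hle ⊢
    exact le_antisymm hle (by positivity)
  have hB1' := (pYT_nonneg hP true t').lt_of_ne' hB1
  have hA0' := (pYT_nonneg hP false t).lt_of_ne' hA0
  have hB0 : pYT P false t' ≠ 0 := by
    intro hB0
    obtain ⟨s, hs⟩ := exists_pos_of_pYT_pos hA0'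
    have hl := hlev s
    have hl' : level ε P t' s = 3 := by simp [level, hB0, hB1]
    have hs1 := (h.two_le_level_iff s hA0).1 (by omega)
    exact hs.ne' (h.eq_zero_of_le ht le_rfl hs1)
  have hB0' := (pYT_nonneg hP false t').lt_of_ne' hB0
  have hA1' : 0 < pYT P true t := by
    obtain ⟨s, hs⟩ := exists_pos_of_pYT_pos hB1'
    have hs1 := (h.two_le_level_iff s hB0).2 hs
    rw [← hlev s, h.two_le_level_iff s hA0] at hs1
    exact hs1.trans_le (Finset.single_le_sum (f := fun r => P r true t)
      (fun r _ => hP.1 r true t) (Finset.mem_univ s))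
  have htrue : ∀ s, 0 < P s true t ↔ 0 < P s true t' := fun s => by
    rw [← h.two_le_level_iff s hA0, ← h.two_le_level_iff s hB0, hlev s]
  have hhigh : ∀ s, IsHigh ε P t s ↔ IsHigh ε P t' s := fun s => by
    have hl := hlev s
    have hi := htrue s
    simp only [level, hA1'.ne', hA0, hB1, hB0, if_false, hi] at hl
    split_ifs at hl <;> simp_all
  have hlow : ∀ s, ¬ IsHigh ε P t s → IsLow ε P t s ∧ IsLow ε P t' s := fun s hs =>
    ⟨(h.isLow_or_isHigh ht hA1' hA0' s).resolve_right hs,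
      (h.isLow_or_isHigh ht' hB1' hB0' s).resolve_right (by rwa [← hhigh s])⟩
  have hc : ∀ s r, condTS P t s * condTS P t' r = condTS P t' s * condTS P t r := by
    intro s r
    by_cases h₁ : IsHigh ε P t s <;> by_cases h₂ : IsHigh ε P t r
    · rw [h₁.condTS_eq hIP h₂, ((hhigh s).1 h₁).condTS_eq hIP ((hhigh r).1 h₂), mul_comm]
    · rw [(hlow r h₂).1.condTS_eq_of_isHigh hIP h₁,
        (hlow r h₂).2.condTS_eq_of_isHigh hIP ((hhigh s).1 h₁)]
      ring
    · rw [(hlow s h₁).1.condTS_eq_of_isHigh hIP h₂,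
        (hlow s h₁).2.condTS_eq_of_isHigh hIP ((hhigh r).1 h₂)]
      ring
    · rw [(hlow s h₁).1.condTS_eq hIP (hlow r h₂).1, (hlow s h₁).2.condTS_eq hIP (hlow r h₂).2,
        mul_comm]
  have hm : ∀ s r, (P s true t + P s false t) * condTS P t' r
      = (P s true t' + P s false t') * condTS P t r := by
    intro s r
    have := congrArg (· * pS P s) (hc s r)
    have hs := (hP.2.2 s).ne'
    simp only [condTS.eq_def P t s, condTS.eq_def P t' s, pST, Fintype.sum_bool] at this
    field_simp at this
    linarith
  have hpure : ∀ s y r, P s y t * condTS P t' r = P s y t' * condTS P t r := by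
    intro s y r
    have hm' := hm s r
    by_cases hs : 0 < P s true t
    · have z := h.eq_zero_of_le ht le_rfl hs
      have z' := h.eq_zero_of_le ht' le_rfl ((htrue s).1 hs)
      cases y
      · simp [z, z']
      · simpa [z, z'] using hm'
    · have z : P s true t = 0 := le_antisymm (not_lt.1 hs) (hP.1 s true t)
      have z' : P s true t' = 0 :=
        le_antisymm (not_lt.1 fun h => hs ((htrue s).2 h)) (hP.1 s true t')
      cases y
      · simpa [z, z'] using hm'
      · simp [z, z']
  obtain ⟨r, -⟩ := exists_pos_of_pYT_pos hA1'
  have hsum : ∀ y, pYT P y t * condTS P t' r = pYT P y t' * condTS P t r := fun y => by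
    simp only [pYT, Finset.sum_mul]
    exact Finset.sum_congr rfl fun s _ => hpure s y r
  refine mul_right_cancel₀ (condTS_pos hP hIP ht' r).ne' ?_
  linear_combination pYT P false t' * hsum true - pYT P true t' * hsum false

theorem BlackwellOptimal.cross_eq_of_sum_level_eq (hε : 0 < ε) (h : BlackwellOptimal ε P)
    (ht : 0 < pT P t) (ht' : 0 < pT P t') (hsum : ∑ s, level ε P t s = ∑ s, level ε P t' s) :
    pYT P true t * pYT P false t' = pYT P true t' * pYT P false t := by
  wlog hle : pYT P true t * pYT P false t' ≤ pYT P true t' * pYT P false t generalizing t t'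
  · exact (this ht' ht hsum.symm (by linarith)).symm
  refine h.cross_eq_of_level_eq ht ht' hle fun s => ?_
  exact (Finset.sum_eq_sum_iff_of_le fun s _ => h.level_mono hε ht ht' hle s).1 hsum s
    (Finset.mem_univ s)

theorem BlackwellOptimal.postYT_eq_of_sum_level_eq (hε : 0 < ε) (h : BlackwellOptimal ε P)
    (ht : 0 < pT P t) (ht' : 0 < pT P t') (hsum : ∑ s, level ε P t s = ∑ s, level ε P t' s) :
    postYT P t = postYT P t' := by
  rw [postYT, postYT, div_eq_div_iff ht.ne' ht'.ne', pT_eq_add, pT_eq_add]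
  linear_combination h.cross_eq_of_sum_level_eq hε ht ht' hsum

end Structure

section Merge

variable {S T K : Type} [Fintype S] [Fintype T] [Fintype K]

/-- The information structure obtained by merging signals along `φ`. -/
def merge (P : S → Bool → T → ℝ) (φ : T → K) : S → Bool → K → ℝ :=
  fun s y k => ∑ t ∈ Finset.univ.filter (fun t => φ t = k), P s y t

variable {P : S → Bool → T → ℝ} {φ : T → K}

theorem pSY_merge (P : S → Bool → T → ℝ) (φ : T → K) (s : S) (y : Bool) :
    pSY (merge P φ) s y = pSY P s y :=
  Finset.sum_fiberwise _ φ _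

theorem pYT_merge (P : S → Bool → T → ℝ) (φ : T → K) (y : Bool) (k : K) :
    pYT (merge P φ) y k = ∑ t ∈ Finset.univ.filter (fun t => φ t = k), pYT P y t :=
  Finset.sum_comm

theorem pT_merge (P : S → Bool → T → ℝ) (φ : T → K) (k : K) :
    pT (merge P φ) k = ∑ t ∈ Finset.univ.filter (fun t => φ t = k), pT P t := by
  simp only [pT_eq_add, pYT_merge, Finset.sum_add_distrib]

theorem InfoStructure.merge (hP : InfoStructure P) (φ : T → K) :
    InfoStructure (IPPaper.merge P φ) :=
  hP.of_pSY_eq (fun s y _ => Finset.sum_nonneg fun t _ => hP.1 s y t) (pSY_merge P φ)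

theorem condTS_merge (P : S → Bool → T → ℝ) (φ : T → K) (k : K) (s : S) :
    condTS (merge P φ) k s = ∑ t ∈ Finset.univ.filter (fun t => φ t = k), condTS P t s := by
  simp only [condTS, pS_congr (pSY_merge P φ), ← Finset.sum_div]
  congr 1
  exact Finset.sum_comm

theorem IsIP.merge {ε : ℝ} (hP : IsIP ε P) (φ : T → K) : IsIP ε (IPPaper.merge P φ) := by
  intro s₁ s₂ k
  rw [condTS_merge, condTS_merge, Finset.mul_sum]
  exact Finset.sum_le_sum fun t _ => hP s₁ s₂ t

theorem pT_nonneg (hP : InfoStructure P) (t : T) : 0 ≤ pT P t := by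
  rw [pT_eq_add]
  exact add_nonneg (pYT_nonneg hP _ _) (pYT_nonneg hP _ _)

theorem pYT_true_eq (hP : InfoStructure P) (t : T) : pYT P true t = pT P t * postYT P t := by
  rcases (pT_nonneg hP t).eq_or_lt with h | h
  · have h1 := pT_eq_add P t
    have := pYT_nonneg hP true t
    have := pYT_nonneg hP false t
    rw [← h, zero_mul]
    linarith
  · rw [postYT, mul_div_cancel₀ _ h.ne']

theorem pT_le_pT_merge (hP : InfoStructure P) (φ : T → K) (t : T) :
    pT P t ≤ pT (merge P φ) (φ t) := by
  rw [pT_merge]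
  exact Finset.single_le_sum (fun r _ => pT_nonneg hP r) (by simp)

/-- Merging signals with equal posteriors does not change the posterior. -/
theorem postYT_merge (hP : InfoStructure P)
    (hφ : ∀ t t', 0 < pT P t → 0 < pT P t' → φ t = φ t' → postYT P t = postYT P t')
    {t : T} (ht : 0 < pT P t) : postYT (merge P φ) (φ t) = postYT P t := by
  have hpos := ht.trans_le (pT_le_pT_merge hP φ t)
  rw [postYT, div_eq_iff hpos.ne', pT_merge, pYT_merge, Finset.mul_sum]
  refine Finset.sum_congr rfl fun r hr => ?_
  rw [pYT_true_eq hP r, mul_comm]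
  rcases (pT_nonneg hP r).eq_or_lt with h | h
  · simp [← h]
  · rw [hφ r t h ht (Finset.mem_filter.1 hr).2]

theorem EU_merge (hP : InfoStructure P)
    (hφ : ∀ t t', 0 < pT P t → 0 < pT P t' → φ t = φ t' → postYT P t = postYT P t')
    (u : ℝ → ℝ) : EU (merge P φ) u = EU P u := by
  have hEU : ∀ {T : Type} [Fintype T] {P : S → Bool → T → ℝ}, InfoStructure P →
      EU P u = ∑ t, pT P t * u (postYT P t) := by
    intro T _ P hP
    refine Finset.sum_filter_of_ne fun t _ h => (pT_nonneg hP t).lt_of_ne' fun h0 => h ?_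
    rw [h0, zero_mul]
  rw [hEU hP, hEU (hP.merge φ), ← Finset.sum_fiberwise Finset.univ φ]
  refine Finset.sum_congr rfl fun k _ => ?_
  rw [pT_merge, Finset.sum_mul]
  refine Finset.sum_congr rfl fun t ht => ?_
  rcases (pT_nonneg hP t).eq_or_lt with h | h
  · simp [← h]
  · rw [← (Finset.mem_filter.1 ht).2, postYT_merge hP hφ h]

theorem blackwellDom_merge (hP : InfoStructure P)
    (hφ : ∀ t t', 0 < pT P t → 0 < pT P t' → φ t = φ t' → postYT P t = postYT P t') :
    BlackwellDom (pYT (merge P φ)) (pYT P) := by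
  obtain ⟨t₀⟩ : Nonempty T := by
    by_contra hT
    rw [not_nonempty_iff] at hT
    simpa using hP.2.1
  have hnn := pT_nonneg (hP.merge φ)
  have htrue : ∀ t, pYT P true t =
      pYT (merge P φ) true (φ t) * (pT P t / pT (merge P φ) (φ t)) := by
    intro t
    rcases (pT_nonneg hP t).eq_or_lt with h | h
    · rw [pYT_true_eq hP t, ← h]; simp
    · have hpos := h.trans_le (pT_le_pT_merge hP φ t)
      rw [pYT_true_eq hP t, pYT_true_eq (hP.merge φ), postYT_merge hP hφ h]
      field_simp
  have hall : ∀ y t, pYT P y t =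
      pYT (merge P φ) y (φ t) * (pT P t / pT (merge P φ) (φ t)) := by
    rintro (_ | _) t
    · have h1 := pT_eq_add P t
      have h2 := pT_eq_add (merge P φ) (φ t)
      have h3 : pT P t = pT (merge P φ) (φ t) * (pT P t / pT (merge P φ) (φ t)) := by
        rcases (hnn (φ t)).eq_or_lt with h | h
        · rw [← h, zero_mul]
          exact le_antisymm (h ▸ pT_le_pT_merge hP φ t) (pT_nonneg hP t)
        · rw [mul_div_cancel₀ _ h.ne']
      have h4 := htrue t
      generalize pT P t / pT (merge P φ) (φ t) = w at *
      rw [h2] at h3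
      linear_combination h3 - h1 - h4
    · exact htrue t
  refine ⟨fun k t => if pT (merge P φ) k = 0 then (if t = t₀ then 1 else 0) else
    if φ t = k then pT P t / pT (merge P φ) k else 0, fun k t => ?_, fun k => ?_, fun y t => ?_⟩
  · have := pT_nonneg hP t
    have := hnn k
    positivity
  · by_cases hk : pT (merge P φ) k = 0
    · simp [hk]
    · simp only [hk, if_false]
      rw [← Finset.sum_filter, ← Finset.sum_div, ← pT_merge, div_self hk]
  · rw [hall y t, Finset.sum_eq_single (φ t)]
    · by_cases hk : pT (merge P φ) (φ t) = 0
      · have h2 := pT_eq_add (merge P φ) (φ t)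
        have := pYT_nonneg (hP.merge φ) true (φ t)
        have := pYT_nonneg (hP.merge φ) false (φ t)
        have : pYT (merge P φ) y (φ t) = 0 := by
          cases y <;> linarith
        simp [this]
      · simp [hk]
    · intro k _ hk
      by_cases hk0 : pT (merge P φ) k = 0
      · have h2 := pT_eq_add (merge P φ) k
        have := pYT_nonneg (hP.merge φ) true k
        have := pYT_nonneg (hP.merge φ) false k
        have : pYT (merge P φ) y k = 0 := by
          cases y <;> linarith
        simp [this]
      · simp [hk0, hk.symm]
    · simp

theorem BlackwellOptimal.merge {ε : ℝ} (h : BlackwellOptimal ε P)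
    (hφ : ∀ t t', 0 < pT P t → 0 < pT P t' → φ t = φ t' → postYT P t = postYT P t') :
    BlackwellOptimal ε (IPPaper.merge P φ) := by
  have hd := blackwellDom_merge h.1 hφ
  refine ⟨h.1.merge φ, h.2.1.merge φ, ?_⟩
  rintro ⟨n, P', hP', hIP', hm, hdom, hn⟩
  exact hn (hd.trans (h.dom_of_dom hP' hIP'
    (fun s y => (hm s y).trans (pSY_merge P φ s y)) (hdom.trans hd)))

end Merge

/-- any ε-IP Blackwell optimal information structure has an
equivalent (merged) optimal structure with at most `3|S|+1` signals. -/
theorem statement3 {S Th : Type} [Fintype S] [Fintype Th]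
    (ε : ℝ) (hε : 0 < ε) (Phat : S → Bool → Th → ℝ)
    (hopt : BlackwellOptimal ε Phat) :
    ∃ (k : ℕ), k ≤ 3 * Fintype.card S + 1 ∧
      ∃ (P : S → Bool → Fin k → ℝ) (φ : Th → Fin k),
        BlackwellOptimal ε P ∧
        (∀ s y, pSY P s y = pSY Phat s y) ∧
        (∀ s y t, P s y t =
          ∑ th ∈ Finset.univ.filter (fun th => φ th = t), Phat s y th) ∧
        ∀ u : ℝ → ℝ, ConvexOn ℝ (Set.Icc 0 1) u → EU P u = EU Phat u := by
  have hlt : ∀ t, ∑ s, level ε Phat t s < 3 * Fintype.card S + 1 := fun t => by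
    have h : ∑ s, level ε Phat t s ≤ Finset.univ.card • 3 :=
      Finset.sum_le_card_nsmul _ _ 3 fun s _ => level_le_three ε Phat t s
    simp only [Finset.card_univ, smul_eq_mul] at h
    omega
  let φ : Th → Fin (3 * Fintype.card S + 1) := fun t => ⟨∑ s, level ε Phat t s, hlt t⟩
  have hφ : ∀ t t', 0 < pT Phat t → 0 < pT Phat t' → φ t = φ t' →
      postYT Phat t = postYT Phat t' := fun t t' ht ht' he =>
    hopt.postYT_eq_of_sum_level_eq hε ht ht' (Fin.mk.inj_iff.1 he)
  refine ⟨_, le_rfl, merge Phat φ, φ, hopt.merge hφ, pSY_merge Phat φ, fun s y t => ?_,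
    fun u _ => EU_merge hopt.1 hφ u⟩
  unfold merge
  congr!

end IPPaper
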